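/- If f is a measure expansive homeomorphism of a compact metric space with the shadowing property, then f has the periodic shadowing property. -/

import Mathlib

open MeasureTheory Filter Metric Topology

variable {X : Type*}

/-- Iterate of a homeomorphism by an integer. -/
noncomputable def zit [TopologicalSpace X] (f : X ≃ₜ X) (i : ℤ) (x : X) : X :=
  (f.toEquiv ^ i) x

/-- The dynamical ball `Γ_δ(x)` of a homeomorphism. -/
def Gamma [MetricSpace X] (f : X ≃ₜ X) (δ : ℝ) (x : X) : Set X :=
  {y | ∀ i : ℤ, dist (zit f i x) (zit f i y) ≤ δ}

/-- Shadowing property for one-sided (ℕ-indexed) pseudo-orbits. -/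
def ShadowingN [MetricSpace X] (f : X → X) : Prop :=
  ∀ ε > (0 : ℝ), ∃ δ > (0 : ℝ), ∀ x : ℕ → X,
    (∀ i, dist (f (x i)) (x (i + 1)) < δ) →
    ∃ y, ∀ i, dist (f^[i] y) (x i) < ε

/-- Shadowing property for two-sided (ℤ-indexed) pseudo-orbits of a homeomorphism. -/
def ShadowingZ [MetricSpace X] (f : X ≃ₜ X) : Prop :=
  ∀ ε > (0 : ℝ), ∃ δ > (0 : ℝ), ∀ x : ℤ → X,
    (∀ i, dist (f (x i)) (x (i + 1)) < δ) →
    ∃ y, ∀ i, dist (zit f i y) (x i) < ε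

/-- Local weak specification property. -/
def LocalWeakSpec [MetricSpace X] (f : X → X) : Prop :=
  ∀ ε > (0 : ℝ), ∃ N : ℕ, ∃ δ > (0 : ℝ), ∀ n, N ≤ n → ∀ (k : ℕ) (x : ℕ → X),
    (∀ i, i + 1 < k → dist (f^[n] (x i)) (x (i + 1)) < δ) →
    ∃ y, ∀ i < k, ∀ j, i * n ≤ j → j < (i + 1) * n →
      dist (f^[j] y) (f^[j - i * n] (x i)) < ε

/-- Local specification property (tracing point is periodic when the chain closes up). -/
def LocalSpec [MetricSpace X] (f : X → X) : Prop :=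
  ∀ ε > (0 : ℝ), ∃ N : ℕ, ∃ δ > (0 : ℝ), ∀ n, N ≤ n → ∀ k, 1 ≤ k → ∀ x : ℕ → X,
    (∀ i < k, dist (f^[n] (x i)) (x ((i + 1) % k)) < δ) →
    ∃ y, f^[k * n] y = y ∧ ∀ i < k, ∀ j, i * n ≤ j → j < (i + 1) * n →
      dist (f^[j] y) (f^[j - i * n] (x i)) < ε

/-- A point is periodic for `f`. -/
def IsPeriodicPt' (f : X → X) (y : X) : Prop := ∃ m, 1 ≤ m ∧ f^[m] y = y

/-- Periodic shadowing property for one-sided pseudo-orbits. -/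
def PeriodicShadowingN [MetricSpace X] (f : X → X) : Prop :=
  ∀ ε > (0 : ℝ), ∃ δ > (0 : ℝ), ∀ x : ℕ → X,
    (∀ i, dist (f (x i)) (x (i + 1)) < δ) →
    (∃ M, 1 ≤ M ∧ ∀ i, x (i + M) = x i) →
    ∃ y, IsPeriodicPt' f y ∧ ∀ i, dist (f^[i] y) (x i) < ε

/-- Periodic shadowing property for two-sided pseudo-orbits of a homeomorphism. -/
def PeriodicShadowingZ [MetricSpace X] (f : X ≃ₜ X) : Prop :=
  ∀ ε > (0 : ℝ), ∃ δ > (0 : ℝ), ∀ x : ℤ → X,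
    (∀ i, dist (f (x i)) (x (i + 1)) < δ) →
    (∃ M : ℕ, 1 ≤ M ∧ ∀ i, x (i + M) = x i) →
    ∃ y, IsPeriodicPt' f y ∧ ∀ i, dist (zit f i y) (x i) < ε

/-- Strong periodic shadowing: the shadowing point has the same period as the pseudo-orbit. -/
def StrongPeriodicShadowingZ [MetricSpace X] (f : X ≃ₜ X) : Prop :=
  ∀ ε > (0 : ℝ), ∃ δ > (0 : ℝ), ∀ (N : ℕ), 1 ≤ N → ∀ x : ℤ → X,
    (∀ i, dist (f (x i)) (x (i + 1)) < δ) →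
    (∀ i, x (i + N) = x i) →
    ∃ y, f^[N] y = y ∧ ∀ i, dist (zit f i y) (x i) < ε

/-- Topological transitivity of a homeomorphism (some point has dense two-sided orbit). -/
def TransitiveZ [TopologicalSpace X] (f : X ≃ₜ X) : Prop :=
  ∃ x : X, Dense (Set.range fun n : ℤ => zit f n x)

/-- Measure expansiveness of a homeomorphism. -/
def MeasExpansive [MetricSpace X] [MeasurableSpace X] (f : X ≃ₜ X) : Prop :=
  ∃ δ > (0 : ℝ), ∀ μ : Measure X, IsProbabilityMeasure μ →
    MeasurePreserving f μ μ → (∀ z : X, μ {z} = 0) →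
    ∀ x : X, μ (Gamma f δ x) = 0

/-- Strong measure expansiveness of a homeomorphism. -/
def StrongMeasExpansive [MetricSpace X] [MeasurableSpace X] (f : X ≃ₜ X) : Prop :=
  ∃ δ > (0 : ℝ), ∀ μ : Measure X, IsProbabilityMeasure μ →
    MeasurePreserving f μ μ → ∀ x : X, μ (Gamma f δ x) = μ {x}

/-- Strong measure expansiveness with a specified constant. -/
def StrongMeasExpansiveWith [MetricSpace X] [MeasurableSpace X] (f : X ≃ₜ X) (δ : ℝ) : Prop :=
  ∀ μ : Measure X, IsProbabilityMeasure μ →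
    MeasurePreserving f μ μ → ∀ x : X, μ (Gamma f δ x) = μ {x}

/-- **Krylov–Bogolyubov theorem**: a continuous self-map of a nonempty compact metric space has an
invariant Borel probability measure. -/
theorem exists_isProbabilityMeasure_measurePreserving {Y : Type*} [MetricSpace Y] [CompactSpace Y]
    [Nonempty Y] [MeasurableSpace Y] [BorelSpace Y] {f : Y → Y} (hf : Continuous f) :
    ∃ μ : Measure Y, IsProbabilityMeasure μ ∧ MeasurePreserving f μ μ := by
  obtain ⟨y⟩ := ‹Nonempty Y›
  let μ : ℕ → Measure Y := fun n =>
    ((n + 1 : ℕ) : ENNReal)⁻¹ • ∑ i ∈ Finset.range (n + 1), Measure.dirac (f^[i] y)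
  have hμ (n : ℕ) : IsProbabilityMeasure (μ n) := by
    constructor
    simp only [μ, Measure.smul_apply, Measure.finsetSum_apply, measure_univ, Finset.sum_const,
      Finset.card_range, nsmul_eq_mul, mul_one, smul_eq_mul]
    exact ENNReal.inv_mul_cancel (by simp) (ENNReal.natCast_ne_top _)
  have hint (n : ℕ) {g : Y → ℝ} (hg : Continuous g) :
      ∫ z, g z ∂μ n = birkhoffAverage ℝ f g (n + 1) y := by
    have hi (i : ℕ) : Integrable g (Measure.dirac (f^[i] y)) :=
      hg.integrable_of_hasCompactSupport (HasCompactSupport.of_compactSpace g)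
    simp only [μ, birkhoffAverage, birkhoffSum]
    rw [integral_smul_measure, integral_finsetSum_measure fun i _ => hi i]
    simp only [integral_dirac, ENNReal.toReal_inv, ENNReal.toReal_natCast]
  let P : ℕ → ProbabilityMeasure Y := fun n => ⟨μ n, hμ n⟩
  let U : Ultrafilter ℕ := hyperfilter ℕ
  have hU : (U : Filter ℕ) ≤ atTop := Nat.hyperfilter_le_atTop
  obtain ⟨ν, -, hν⟩ := isCompact_univ.ultrafilter_le_nhds (U.map P) (by simp)
  have hlim : Tendsto P U (𝓝 ν) := hν
  rw [ProbabilityMeasure.tendsto_iff_forall_integral_tendsto] at hlim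
  refine ⟨ν, inferInstance, hf.measurable, ?_⟩
  have : IsProbabilityMeasure ((ν : Measure Y).map f) :=
    Measure.isProbabilityMeasure_map hf.measurable.aemeasurable
  refine ext_of_forall_integral_eq_of_IsFiniteMeasure fun g => ?_
  rw [integral_map hf.measurable.aemeasurable g.continuous.aestronglyMeasurable]
  have h₁ := (hlim (g.compContinuous ⟨f, hf⟩)).sub (hlim g)
  have h₂ : Tendsto (fun n => ∫ z, g (f z) ∂μ n - ∫ z, g z ∂μ n) U (𝓝 0) := by
    have h := tendsto_birkhoffAverage_apply_sub_birkhoffAverage' (𝕜 := ℝ) (g := g)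
      g.isBounded_range f y
    refine ((h.comp (tendsto_add_atTop_nat 1)).mono_left hU).congr fun n => ?_
    rw [hint n g.continuous, hint n (g := fun z => g (f z)) (g.continuous.comp hf)]
    simp only [Function.comp_apply, birkhoffAverage, birkhoffSum, ← Function.iterate_succ_apply,
      ← Function.iterate_succ_apply']
  exact sub_eq_zero.1 (tendsto_nhds_unique h₁ h₂)

theorem IsClosed.exists_isProbabilityMeasure_measurePreserving [MetricSpace X] [CompactSpace X]
    [MeasurableSpace X] [BorelSpace X] {f : X → X} (hf : Continuous f) {A : Set X}
    (hA : IsClosed A) (hne : A.Nonempty) (hfA : Set.MapsTo f A A) :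
    ∃ μ : Measure X, IsProbabilityMeasure μ ∧ MeasurePreserving f μ μ ∧ μ Aᶜ = 0 := by
  have := isCompact_iff_compactSpace.1 hA.isCompact
  have := hne.to_subtype
  obtain ⟨μ, hμ, hinv⟩ := _root_.exists_isProbabilityMeasure_measurePreserving
    (hf.restrict hfA)
  have hm : Measurable ((↑) : A → X) := measurable_subtype_coe
  refine ⟨μ.map (↑), Measure.isProbabilityMeasure_map hm.aemeasurable,
    ⟨hf.measurable, ?_⟩, ?_⟩
  · have hcomp : f ∘ ((↑) : A → X) = (↑) ∘ hfA.restrict f A A := rfl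
    rw [Measure.map_map hf.measurable hm, hcomp, ← Measure.map_map hm hinv.measurable, hinv.map_eq]
  · rw [Measure.map_apply hm hA.measurableSet.compl]
    simp

theorem zit_add [TopologicalSpace X] (f : X ≃ₜ X) (i j : ℤ) (x : X) :
    zit f (i + j) x = zit f i (zit f j x) := by
  simp [zit, zpow_add]

theorem zit_natCast [TopologicalSpace X] (f : X ≃ₜ X) (n : ℕ) (x : X) :
    zit f n x = f^[n] x := by
  rw [zit, zpow_natCast, Equiv.Perm.coe_pow]
  rfl

theorem continuous_zit [TopologicalSpace X] (f : X ≃ₜ X) (i : ℤ) : Continuous (zit f i) := by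
  obtain ⟨n, rfl | rfl⟩ := i.eq_nat_or_neg
  · exact (f.continuous.iterate n).congr fun x => (zit_natCast f n x).symm
  · refine (f.symm.continuous.iterate n).congr fun x => ?_
    rw [zit, zpow_neg, zpow_natCast, ← inv_pow, Equiv.Perm.coe_pow]
    rfl

/-- The points whose orbit stays within `r` of the sequence `x`. -/
def tracingSet [MetricSpace X] (f : X ≃ₜ X) (r : ℝ) (x : ℤ → X) : Set X :=
  {y | ∀ i : ℤ, dist (zit f i y) (x i) ≤ r}

theorem isClosed_tracingSet [MetricSpace X] (f : X ≃ₜ X) (r : ℝ) (x : ℤ → X) :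
    IsClosed (tracingSet f r x) := by
  simp only [tracingSet, Set.ofPred_forall]
  exact isClosed_iInter fun i =>
    isClosed_le ((continuous_zit f i).dist continuous_const) continuous_const

theorem zit_mem_tracingSet [MetricSpace X] {f : X ≃ₜ X} {r : ℝ} {x : ℤ → X} {y : X}
    (hy : y ∈ tracingSet f r x) (j : ℤ) :
    zit f j y ∈ tracingSet f r fun i => x (i + j) := by
  intro i
  rw [← zit_add]
  exact hy (i + j)

theorem tracingSet_subset_Gamma [MetricSpace X] {f : X ≃ₜ X} {r δ : ℝ} {x : ℤ → X} {y : X}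
    (hr : 2 * r ≤ δ) (hy : y ∈ tracingSet f r x) : tracingSet f r x ⊆ Gamma f δ y := by
  intro z hz i
  linarith [hy i, hz i, dist_triangle_right (zit f i y) (zit f i z) (x i)]

/-- If `f` is measure expansive at scale `δ`, a periodic sequence traced at scale `δ / 2` is traced
by a periodic point. -/
theorem exists_isPeriodicPt_mem_tracingSet [MetricSpace X] [CompactSpace X] [MeasurableSpace X]
    [BorelSpace X] {f : X ≃ₜ X} {δ r : ℝ} (hr : 2 * r ≤ δ)
    (hδ : ∀ μ : Measure X, IsProbabilityMeasure μ → MeasurePreserving f μ μ →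
      (∀ z : X, μ {z} = 0) → ∀ x : X, μ (Gamma f δ x) = 0)
    {x : ℤ → X} {M : ℕ} (hM : 1 ≤ M) (hx : ∀ i, x (i + M) = x i)
    (hne : (tracingSet f r x).Nonempty) : ∃ y ∈ tracingSet f r x, IsPeriodicPt' f y := by
  let S : ℕ → Set X := fun j => tracingSet f r fun i => x (i + j)
  have hS0 : S 0 = tracingSet f r x := by simp [S]
  have hSM : S M = S 0 := by simp [S, hx]
  have hfS (j : ℕ) {y : X} (hy : y ∈ S j) : f y ∈ S (j + 1) := by
    have h := zit_mem_tracingSet hy 1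
    have h1 : zit f 1 y = f y := by simpa using zit_natCast f 1 y
    rw [h1] at h
    simpa [S, add_assoc, add_comm (j : ℤ) 1] using h
  let A : Set X := ⋃ j ∈ Finset.range M, S j
  have hAc : IsClosed A := isClosed_biUnion_finset fun j _ => isClosed_tracingSet f r _
  have hAne : A.Nonempty := by
    obtain ⟨y, hy⟩ := hne
    exact ⟨y, Set.mem_biUnion (x := 0) (by simpa using Nat.lt_of_succ_le hM) (hS0 ▸ hy)⟩
  have hfA : Set.MapsTo f A A := by
    intro y hy
    simp only [A, Set.mem_iUnion, Finset.mem_range] at hy ⊢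
    obtain ⟨j, hj, hy⟩ := hy
    obtain h | h := (Nat.succ_le_of_lt hj).lt_or_eq
    · exact ⟨j + 1, h, hfS j hy⟩
    · refine ⟨0, hM, hSM ▸ ?_⟩
      rw [← h]
      exact hfS j hy
  obtain ⟨μ, hμ, hinv, hμA⟩ :=
    hAc.exists_isProbabilityMeasure_measurePreserving f.continuous hAne hfA
  obtain ⟨z, hz⟩ : ∃ z, μ {z} ≠ 0 := by
    by_contra! hna
    have hA0 : μ A = 0 := by
      refine (measure_biUnion_null_iff (Finset.countable_toSet _)).2 fun j _ => ?_
      obtain h | ⟨y, hy⟩ := (S j).eq_empty_or_nonempty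
      · simp [h]
      · exact measure_mono_null (tracingSet_subset_Gamma hr hy) (hδ μ hμ hinv hna y)
    have huniv : μ (A ∪ Aᶜ) = 0 := measure_union_null hA0 hμA
    simp at huniv
  have hzA : z ∈ A := by
    by_contra h
    exact hz (measure_mono_null (Set.singleton_subset_iff.2 h) hμA)
  obtain ⟨w, rfl, m, hm, hmw⟩ :=
    hinv.exists_mem_iterate_mem (measurableSet_singleton z).nullMeasurableSet hz
  simp only [A, Set.mem_iUnion] at hzA
  obtain ⟨j, -, hj⟩ := hzA
  refine ⟨zit f (-j) w, by simpa using zit_mem_tracingSet hj (-j), m, by omega, ?_⟩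
  rw [← zit_natCast, ← zit_add, add_comm, zit_add, zit_natCast, Set.mem_singleton_iff.1 hmw]

theorem measExpansive_shadowing_implies_periodicShadowing
    [MetricSpace X] [CompactSpace X] [MeasurableSpace X] [BorelSpace X]
    (f : X ≃ₜ X) (hme : MeasExpansive f) (hsh : ShadowingZ f) :
    PeriodicShadowingZ f := by
  intro ε hε
  obtain ⟨δ, hδ, hμ⟩ := hme
  obtain ⟨η, hη, hshadow⟩ := hsh (min (δ / 2) (ε / 2)) (by positivity)
  refine ⟨η, hη, fun x hx ⟨M, hM, hper⟩ => ?_⟩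
  obtain ⟨y, hy⟩ := hshadow x hx
  obtain ⟨z, hz, hzper⟩ := exists_isPeriodicPt_mem_tracingSet
    (by linarith [min_le_left (δ / 2) (ε / 2)]) hμ hM hper ⟨y, fun i => (hy i).le⟩
  exact ⟨z, hzper, fun i => by linarith [hz i, min_le_right (δ / 2) (ε / 2)]⟩
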